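/- Let q, v : ℝ → ℝ be differentiable functions and let K(x,λ) = λ + v(x) + q(x)/λ. For each integer n ≥ 0 define the function c_n(x,λ) = K(x,λ)^{−n} · ∑_{k=0}^{n} (−1)^{n−k} s(n,k) · (log(K(x,λ)/λ))^{n−k+1} / (n−k+1)!, on the domain where λ > 0 and K(x,λ) > 0, and set c_{−1} := K. Then for every n ≥ 0 and every (x,λ) with λ > 0 and K(x,λ) > 0: {K, c_n}(x,λ) = ∂_x c_{n−1}(x,λ). (This is the order-by-order form in τ of the first half of Theorem 5.1: the series 𝕃₀ = K₀ + ∑_{n≥0} τ^{n+1} c_n satisfies the dispersionless Lax constraint {K₀, 𝕃₀} = τ ∂𝕃₀.) -/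

import Mathlib

/-- The dispersionless Poisson bracket of two functions `A, B` of `(x, λ)`:
`{A,B}(x,λ) = λ·∂_λA·∂_xB − ∂_xA·λ·∂_λB`. -/
noncomputable def poissonBracket (A B : ℝ → ℝ → ℝ) (x l : ℝ) : ℝ :=
  l * deriv (A x) l * deriv (fun y => B y l) x -
    deriv (fun y => A y l) x * (l * deriv (B x) l)

/-- The dispersionless Lax symbol `K(x,λ) = λ + v(x) + q(x)/λ`. -/
noncomputable def laxSymbol (q v : ℝ → ℝ) (x l : ℝ) : ℝ := l + v x + q x / l

/-- The unsigned Stirling number of the first kind `s(n,k)`, defined as the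
coefficient of `X^k` in the ascending factorial `X(X+1)⋯(X+n-1)`. -/
noncomputable def stirlingFirst (n k : ℕ) : ℚ := (ascPochhammer ℚ n).coeff k

/-- The coefficient of `τ^{n+1}` in the dispersionless Lax operator `𝕃₀`:
`c_n(x,λ) = K(x,λ)^{−n} ∑_{k=0}^{n} (−1)^{n−k} s(n,k) log(K(x,λ)/λ)^{n−k+1}/(n−k+1)!`. -/
noncomputable def laxCoeff (q v : ℝ → ℝ) (n : ℕ) (x l : ℝ) : ℝ :=
  laxSymbol q v x l ^ (-(n : ℤ)) *
    ∑ k ∈ Finset.range (n + 1),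
      (-1 : ℝ) ^ (n - k) * (stirlingFirst n k : ℝ) *
        Real.log (laxSymbol q v x l / l) ^ (n - k + 1) / ((n - k + 1).factorial : ℝ)

noncomputable def auxP (n : ℕ) (L : ℝ) : ℝ :=
  ∑ k ∈ Finset.range (n + 1),
      (-1 : ℝ) ^ (n - k) * (stirlingFirst n k : ℝ) *
        L ^ (n - k + 1) / ((n - k + 1).factorial : ℝ)

noncomputable def auxQ (n : ℕ) (L : ℝ) : ℝ :=
  ∑ k ∈ Finset.range (n + 1),
      (-1 : ℝ) ^ (n - k) * (stirlingFirst n k : ℝ) *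
        L ^ (n - k) / ((n - k).factorial : ℝ)

lemma auxP_deriv (n : ℕ) (L : ℝ) : HasDerivAt (auxP n) (auxQ n L) L := by
  unfold auxP auxQ
  apply HasDerivAt.fun_sum
  intro k _
  have h := ((hasDerivAt_pow (n - k + 1) L).const_mul
    ((-1 : ℝ) ^ (n - k) * (stirlingFirst n k : ℝ))).div_const ((n - k + 1).factorial : ℝ)
  refine h.congr_deriv ?_
  rw [Nat.factorial_succ]
  have : ((n - k).factorial : ℝ) ≠ 0 := by positivity
  have h2 : (((n - k : ℕ) : ℝ) + 1) ≠ 0 := by positivity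
  push_cast
  try simp only [Nat.add_sub_cancel]
  field_simp

lemma st_succ (m k : ℕ) : stirlingFirst (m + 1) (k + 1) =
    stirlingFirst m k + m * stirlingFirst m (k + 1) := by
  unfold stirlingFirst
  rw [ascPochhammer_succ_right, mul_add, Polynomial.coeff_add, Polynomial.coeff_mul_X,
    ← Polynomial.C_eq_natCast, Polynomial.coeff_mul_C, mul_comm]

lemma st_zero (m : ℕ) : (m : ℚ) * stirlingFirst m 0 = 0 := by
  unfold stirlingFirst
  rw [Polynomial.coeff_zero_eq_eval_zero, ascPochhammer_eval_zero]
  split_ifs with h <;> simp [h]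

lemma st_zero' (m : ℕ) : stirlingFirst (m + 1) 0 = 0 := by
  unfold stirlingFirst
  rw [Polynomial.coeff_zero_eq_eval_zero, ascPochhammer_eval_zero]
  simp

lemma st_top (m : ℕ) : stirlingFirst m (m + 1) = 0 := by
  unfold stirlingFirst
  apply Polynomial.coeff_eq_zero_of_natDegree_lt
  rw [ascPochhammer_natDegree]; omega

lemma auxQ_succ (m : ℕ) (L : ℝ) : auxQ (m + 1) L = auxQ m L - m * auxP m L := by
  have h0 : (m : ℝ) * (stirlingFirst m 0 : ℝ) = 0 := by exact_mod_cast st_zero m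
  have e1 : (m : ℝ) * auxP m L = -∑ k ∈ Finset.range (m + 1),
      (-1 : ℝ) ^ (m - k) * (m * (stirlingFirst m (k + 1) : ℝ)) *
        L ^ (m - k) / ((m - k).factorial : ℝ) := by
    unfold auxP
    rw [Finset.sum_range_succ', Finset.sum_range_succ, st_top, mul_add]
    have : (m : ℝ) * ((-1 : ℝ) ^ (m - 0) * (stirlingFirst m 0 : ℝ) *
        L ^ (m - 0 + 1) / ((m - 0 + 1).factorial : ℝ)) = 0 := by
      linear_combination ((-1 : ℝ) ^ (m - 0) *
        L ^ (m - 0 + 1) / ((m - 0 + 1).factorial : ℝ)) * h0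
    rw [this]
    simp only [Rat.cast_zero, mul_zero, zero_mul, zero_div, add_zero]
    rw [Finset.mul_sum, ← Finset.sum_neg_distrib]
    apply Finset.sum_congr rfl
    intro k hk
    have hk' := Finset.mem_range.1 hk
    obtain ⟨d, rfl⟩ : ∃ d, m = k + 1 + d := ⟨m - (k + 1), by omega⟩
    have a1 : k + 1 + d - (k + 1) = d := by omega
    have a2 : k + 1 + d - k = d + 1 := by omega
    rw [a1, a2]
    ring
  rw [e1]
  unfold auxQ
  rw [Finset.sum_range_succ', st_zero', sub_neg_eq_add, ← Finset.sum_add_distrib]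
  simp only [Rat.cast_zero, mul_zero, zero_mul, zero_div, add_zero]
  apply Finset.sum_congr rfl
  intro k _
  rw [st_succ, Nat.add_sub_add_right]
  push_cast
  ring

lemma coeff_deriv (K : ℝ → ℝ) (g : ℝ → ℝ) (K' g' t : ℝ) (n : ℕ) (hK : HasDerivAt K K' t)
    (hg : HasDerivAt g g' t) (hK0 : 0 < K t) (hg0 : 0 < g t) :
    HasDerivAt (fun s => K s ^ (-(n : ℤ)) * auxP n (Real.log (K s / g s)))
      (K t ^ (-(n : ℤ)) * (-n * K' / K t * auxP n (Real.log (K t / g t)) +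
        auxQ n (Real.log (K t / g t)) * (K' / K t - g' / g t))) t := by
  have h1 := (hasDerivAt_zpow (-(n : ℤ)) (K t) (Or.inl hK0.ne')).comp t hK
  have h2 := (hK.div hg hg0.ne').log (div_pos hK0 hg0).ne'
  have h3 := (auxP_deriv n _).comp t h2
  have h := h1.mul h3
  refine h.congr_deriv ?_
  simp only [Function.comp, Pi.div_apply]
  rw [zpow_sub_one₀ hK0.ne']
  push_cast
  field_simp

/-- order-by-order form in `τ` of the first half of Theorem 5.1:
with `c_{−1} := K`, for every `n ≥ 0` and every point with `λ > 0` and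
`K(x,λ) > 0`, one has `{K, c_n}(x,λ) = ∂_x c_{n−1}(x,λ)`. -/
theorem dispersionless_lax_recursion (q v : ℝ → ℝ)
    (hq : Differentiable ℝ q) (hv : Differentiable ℝ v) :
    ∀ (n : ℕ) (x l : ℝ), 0 < l → 0 < laxSymbol q v x l →
      poissonBracket (laxSymbol q v) (fun y μ => laxCoeff q v n y μ) x l =
        deriv (fun y =>
          if n = 0 then laxSymbol q v y l else laxCoeff q v (n - 1) y l) x := by
  intro n x l hl hK
  have hKx : HasDerivAt (fun y => laxSymbol q v y l) (deriv v x + deriv q x / l) x := by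
    have := (((hv x).hasDerivAt.const_add l)).add ((hq x).hasDerivAt.div_const l)
    exact this
  obtain ⟨D, hKl⟩ : ∃ D, HasDerivAt (laxSymbol q v x) D l := by
    have := ((hasDerivAt_id l).add_const (v x)).add
      ((hasDerivAt_const l (q x)).div (hasDerivAt_id l) hl.ne')
    exact ⟨_, this⟩
  have hcx : ∀ m, HasDerivAt (fun y => laxCoeff q v m y l) _ x := fun m =>
    coeff_deriv (fun y => laxSymbol q v y l) (fun _ => l) _ _ x m hKx (hasDerivAt_const x l) hK hl
  have hcl : HasDerivAt (fun μ => laxCoeff q v n x μ) _ l :=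
    coeff_deriv (laxSymbol q v x) (fun s => s) _ _ l n hKl (hasDerivAt_id' l) hK hl
  unfold poissonBracket
  rw [hKx.deriv, hKl.deriv, (hcx n).deriv, hcl.deriv]
  rcases n with _ | m
  · simp only [if_true]
    rw [hKx.deriv]
    have : auxQ 0 (Real.log (laxSymbol q v x l / l)) = 1 := by
      simp [auxQ, stirlingFirst]
    rw [this]
    simp
    field_simp
    ring
  · simp only [Nat.add_sub_cancel, Nat.succ_ne_zero, if_false]
    rw [(hcx m).deriv, auxQ_succ]
    have : laxSymbol q v x l ^ (-((m + 1 : ℕ) : ℤ)) =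
        laxSymbol q v x l ^ (-(m : ℤ)) * (laxSymbol q v x l)⁻¹ := by
      rw [← zpow_sub_one₀ hK.ne']; congr 1; push_cast; ring
    rw [this]
    push_cast
    field_simp
    ring
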